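/- arXiv:1709.09149 — 4 statements merged into one kernel-verified Lean document; each statement's English description precedes it below -/
import Mathlib

section
/- The FRT algebra Õ_q(Mat_N) has a PBW basis: the set of ordered monomials x^{i_1}_{j_1} x^{i_2}_{j_2} ⋯ x^{i_r}_{j_r}, where r ≥ 0 and (i_1,j_1) ≤ (i_2,j_2) ≤ … ≤ (i_r,j_r) in the lexicographic order on pairs (so (i,j) ≤ (k,l) iff i < k, or i = k and j ≤ l), is a basis of Õ_q(Mat_N) as an F-vector space (the empty monomial being 1). -/
open scoped BigOperators

noncomputable section

/-- The ground field `F = ℚ(q)`. -/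
abbrev F : Type := RatFunc ℚ

/-- The variable `q ∈ F`. -/
def q : F := RatFunc.X

/-- The free algebra on the generators `x^i_j`. -/
abbrev FX (N : ℕ) := FreeAlgebra F (Fin N × Fin N)

/-- The generator `x^i_j` of the free algebra. -/
def Xgen (N : ℕ) (i j : Fin N) : FX N := FreeAlgebra.ι F (i, j)

/-- The FRT relations: for `i < j` and `k < l`,
`x^i_k x^i_l = q x^i_l x^i_k`, `x^i_k x^j_k = q x^j_k x^i_k`, `x^i_l x^j_k = x^j_k x^i_l`,
and `x^i_k x^j_l = x^j_l x^i_k + (q − q⁻¹) x^i_l x^j_k`. -/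
inductive FRTrel (N : ℕ) : FX N → FX N → Prop
  | row (i k l : Fin N) : k < l →
      FRTrel N (Xgen N i k * Xgen N i l) (q • (Xgen N i l * Xgen N i k))
  | col (i j k : Fin N) : i < j →
      FRTrel N (Xgen N i k * Xgen N j k) (q • (Xgen N j k * Xgen N i k))
  | anti (i j k l : Fin N) : i < j → k < l →
      FRTrel N (Xgen N i l * Xgen N j k) (Xgen N j k * Xgen N i l)
  | main (i j k l : Fin N) : i < j → k < l →
      FRTrel N (Xgen N i k * Xgen N j l)
        (Xgen N j l * Xgen N i k + (q - q⁻¹) • (Xgen N i l * Xgen N j k))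

/-- The FRT algebra `Õ_q(Mat_N)`. -/
abbrev FRT (N : ℕ) := RingQuot (FRTrel N)

/-- The generator `x^i_j` of the FRT algebra. -/
def xg (N : ℕ) (i j : Fin N) : FRT N :=
  RingQuot.mkAlgHom F (FRTrel N) (Xgen N i j)

/-- Lists of index pairs that are weakly increasing for the lexicographic order
(`(i,j) ≤ (k,l)` iff `i < k`, or `i = k` and `j ≤ l`). -/
def orderedFRT (N : ℕ) : Set (List (Fin N × Fin N)) :=
  {l | l.Chain' fun p r => p.1 < r.1 ∨ (p.1 = r.1 ∧ p.2 ≤ r.2)}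

namespace FRTFock

variable {K : Type*} [Field K] {N : ℕ}

/-- `t` if the two indices agree, `1` otherwise. -/
def eqWeight (t : K) (a b : Fin N) : K := if a = b then t else 1

/-- `t - t⁻¹` if `a < b`, `0` otherwise. -/
def ltWeight (t : K) (a b : Fin N) : K := if a < b then t - t⁻¹ else 0

/-- The scalar `t ^ (-α a)`. -/
def expAt (t : K) (α : Fin N → ℤ) (a : Fin N) : K := t ^ (-α a)

/-- The scalar `t ^ (-∑ i < k, α i)`. -/
def expBelow (t : K) (α : Fin N → ℤ) (k : Fin N) : K := t ^ (-∑ i ∈ Finset.Iio k, α i)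

/-- The coefficient of the operator `D_{ak}`. These operators arise when a generator of a lower
row is moved past an ordered monomial in the generators of the row above it. -/
def dCoeff (t : K) (a k : Fin N) (α : Fin N → ℤ) : K :=
  if a = k then expAt t α a
  else if a < k then
    -t * ((expAt t α a)⁻¹ - expAt t α a) * expBelow t α k * (expBelow t α a)⁻¹
  else 0

theorem expAt_ne_zero {t : K} (ht : t ≠ 0) (α : Fin N → ℤ) (a : Fin N) :
    expAt t α a ≠ 0 := zpow_ne_zero _ ht

theorem expBelow_ne_zero {t : K} (ht : t ≠ 0) (α : Fin N → ℤ) (a : Fin N) :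
    expBelow t α a ≠ 0 := zpow_ne_zero _ ht

theorem expAt_add_single {t : K} (ht : t ≠ 0) (α : Fin N → ℤ) (a l : Fin N) :
    expAt t (α + Pi.single l 1) a = expAt t α a * (if a = l then t⁻¹ else 1) := by
  unfold expAt
  by_cases h : a = l
  · subst h
    simp [zpow_add₀ ht, mul_comm]
  · simp [h]

theorem expAt_sub_single {t : K} (ht : t ≠ 0) (α : Fin N → ℤ) (a l : Fin N) :
    expAt t (α - Pi.single l 1) a = expAt t α a * (if a = l then t else 1) := by
  unfold expAt
  by_cases h : a = l
  · subst h
    simp [sub_eq_add_neg, zpow_add₀ ht, mul_comm]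
  · simp [h]

theorem expBelow_add_single {t : K} (ht : t ≠ 0) (α : Fin N → ℤ) (k l : Fin N) :
    expBelow t (α + Pi.single l 1) k = expBelow t α k * (if l < k then t⁻¹ else 1) := by
  unfold expBelow
  by_cases h : l < k
  · simp [h, Finset.sum_add_distrib, zpow_add₀ ht, mul_comm]
  · simp [h, Finset.sum_add_distrib]

theorem expBelow_sub_single {t : K} (ht : t ≠ 0) (α : Fin N → ℤ) (k l : Fin N) :
    expBelow t (α - Pi.single l 1) k = expBelow t α k * (if l < k then t else 1) := by
  have h := expBelow_add_single ht (α - Pi.single l 1) k l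
  rw [sub_add_cancel] at h
  rw [h]
  split_ifs <;> field_simp

set_option maxHeartbeats 1000000 in
theorem dCoeff_rtt {t : K} (ht : t ≠ 0) (a b k l : Fin N) (α : Fin N → ℤ) :
    eqWeight t a b * (dCoeff t a k (α + Pi.single l 1 - Pi.single b 1) * dCoeff t b l α) +
      ltWeight t b a * (dCoeff t b k (α + Pi.single l 1 - Pi.single a 1) * dCoeff t a l α) =
    eqWeight t k l * (dCoeff t b l (α + Pi.single k 1 - Pi.single a 1) * dCoeff t a k α) +
      ltWeight t k l * (dCoeff t b k (α + Pi.single l 1 - Pi.single a 1) * dCoeff t a l α) := by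
  have ha := expAt_ne_zero ht α a
  have hb := expAt_ne_zero ht α b
  have ha' := expBelow_ne_zero ht α a
  have hb' := expBelow_ne_zero ht α b
  simp only [dCoeff, eqWeight, ltWeight, expAt_sub_single ht, expAt_add_single ht,
    expBelow_sub_single ht, expBelow_add_single ht]
  rcases lt_trichotomy a b with h1 | h1 | h1 <;>
  rcases lt_trichotomy k l with h2 | h2 | h2 <;>
  rcases lt_trichotomy a k with h3 | h3 | h3 <;>
  rcases lt_trichotomy a l with h4 | h4 | h4 <;>
  rcases lt_trichotomy b k with h5 | h5 | h5 <;>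
  rcases lt_trichotomy b l with h6 | h6 | h6 <;>
  first
  | (exfalso; omega)
  | skip
  all_goals
    (try subst h1)
    (try subst h2)
    (try subst h3)
    (try subst h4)
    (try subst h5)
    (try subst h6)
    simp [*, ne_of_lt, ne_of_gt, lt_asymm] <;> field_simp <;> ring

set_option maxHeartbeats 1000000 in
theorem dCoeff_mixed {t : K} (ht : t ≠ 0) (b k l : Fin N) (α : Fin N → ℤ) :
    expBelow t (α + Pi.single l 1 - Pi.single b 1) k * dCoeff t b l α =
      eqWeight t k l * (dCoeff t b l (α + Pi.single k 1) * expBelow t α k) +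
      ltWeight t k l * (dCoeff t b k (α + Pi.single l 1) * expBelow t α l) := by
  have hb := expAt_ne_zero ht α b
  have hb' := expBelow_ne_zero ht α b
  simp only [dCoeff, eqWeight, ltWeight, expAt_add_single ht,
    expBelow_sub_single ht, expBelow_add_single ht]
  rcases lt_trichotomy k l with h2 | h2 | h2 <;>
  rcases lt_trichotomy b k with h5 | h5 | h5 <;>
  rcases lt_trichotomy b l with h6 | h6 | h6 <;>
  first
  | (exfalso; omega)
  | skip
  all_goals
    (try subst h2)
    (try subst h5)
    (try subst h6)
    simp [*, ne_of_lt, ne_of_gt, lt_asymm] <;> field_simp <;> ring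

theorem expBelow_comm {t : K} (ht : t ≠ 0) (k l : Fin N) (α : Fin N → ℤ) :
    t * (expBelow t (α + Pi.single l 1) k * expBelow t α l) =
      eqWeight t k l * (expBelow t (α + Pi.single k 1) l * expBelow t α k) +
      ltWeight t k l * (expBelow t (α + Pi.single l 1) k * expBelow t α l) := by
  simp only [eqWeight, ltWeight, expBelow_add_single ht]
  rcases lt_trichotomy k l with h2 | h2 | h2
  · simp [h2, h2.ne, h2.not_gt]; field_simp; ring
  · subst h2; simp
  · simp [h2, h2.ne', h2.not_gt]; field_simp

/-- The Fock space with basis indexed by sequences of exponent vectors. -/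
abbrev Fock (K : Type*) [Field K] (N : ℕ) := (ℕ → Fin N → ℤ) →₀ K

/-- The weighted shift acting on the copy `r`, sending `e_α` to `c (α r) • e_{α + σ}`,
where `σ` is added to the entry `r` of `α`. -/
def wshift (r : ℕ) (σ : Fin N → ℤ) (c : (Fin N → ℤ) → K) : Module.End K (Fock K N) :=
  Finsupp.linearCombination K
    fun α => Finsupp.single (Function.update α r (α r + σ)) (c (α r))

@[simp]
theorem wshift_single (r : ℕ) (σ : Fin N → ℤ) (c : (Fin N → ℤ) → K) (α : ℕ → Fin N → ℤ)
    (x : K) : wshift r σ c (Finsupp.single α x) =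
      Finsupp.single (Function.update α r (α r + σ)) (x * c (α r)) := by
  simp [wshift]

theorem wshift_mul (r : ℕ) (σ τ : Fin N → ℤ) (c d : (Fin N → ℤ) → K) :
    wshift r σ c * wshift r τ d = wshift r (σ + τ) fun β => c (β + τ) * d β := by
  refine Finsupp.lhom_ext fun α x => ?_
  simp [-Finsupp.single_mul, Module.End.mul_apply, add_assoc, add_comm τ σ, mul_assoc,
    mul_comm (d _)]

theorem wshift_add (r : ℕ) (σ : Fin N → ℤ) (c d : (Fin N → ℤ) → K) :
    wshift r σ c + wshift r σ d = wshift r σ fun β => c β + d β := by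
  refine Finsupp.lhom_ext fun α x => ?_
  simp [mul_add]

theorem wshift_smul (r : ℕ) (σ : Fin N → ℤ) (a : K) (c : (Fin N → ℤ) → K) :
    a • wshift r σ c = wshift r σ fun β => a * c β := by
  refine Finsupp.lhom_ext fun α x => ?_
  simp [-Finsupp.single_mul, mul_left_comm]

theorem wshift_commute {r s : ℕ} (h : r ≠ s) (σ τ : Fin N → ℤ) (c d : (Fin N → ℤ) → K) :
    Commute (wshift r σ c) (wshift s τ d) := by
  refine Finsupp.lhom_ext fun α x => ?_
  simp [-Finsupp.single_mul, Module.End.mul_apply, h, h.symm, Function.update_comm h,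
    mul_right_comm]

/-- The operator `D_{ak}` on the copy `r`. -/
def dOp (t : K) (r : ℕ) (a k : Fin N) : Module.End K (Fock K N) :=
  wshift r (Pi.single k 1 - Pi.single a 1) (dCoeff t a k)

/-- The creation operator `z_k` on the copy `r`. -/
def zOp (t : K) (r : ℕ) (k : Fin N) : Module.End K (Fock K N) :=
  wshift r (Pi.single k 1) fun α => expBelow t α k

theorem dOp_rtt {t : K} (ht : t ≠ 0) (r : ℕ) (a b k l : Fin N) :
    eqWeight t a b • (dOp t r a k * dOp t r b l) +
      ltWeight t b a • (dOp t r b k * dOp t r a l) =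
    eqWeight t k l • (dOp t r b l * dOp t r a k) +
      ltWeight t k l • (dOp t r b k * dOp t r a l) := by
  have e1 : (Pi.single k 1 - Pi.single b 1 + (Pi.single l 1 - Pi.single a 1) : Fin N → ℤ) =
      Pi.single k 1 - Pi.single a 1 + (Pi.single l 1 - Pi.single b 1) := by abel
  have e2 : (Pi.single l 1 - Pi.single b 1 + (Pi.single k 1 - Pi.single a 1) : Fin N → ℤ) =
      Pi.single k 1 - Pi.single a 1 + (Pi.single l 1 - Pi.single b 1) := by abel
  simp only [dOp, wshift_mul, wshift_smul, e1, e2, wshift_add, ← add_sub_assoc]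
  congr 1
  funext α
  exact dCoeff_rtt ht a b k l α

theorem zOp_dOp {t : K} (ht : t ≠ 0) (r : ℕ) (b k l : Fin N) :
    zOp t r k * dOp t r b l =
      eqWeight t k l • (dOp t r b l * zOp t r k) +
        ltWeight t k l • (dOp t r b k * zOp t r l) := by
  have e1 : (Pi.single l 1 - Pi.single b 1 + Pi.single k 1 : Fin N → ℤ) =
      Pi.single k 1 + (Pi.single l 1 - Pi.single b 1) := by abel
  have e2 : (Pi.single k 1 - Pi.single b 1 + Pi.single l 1 : Fin N → ℤ) =
      Pi.single k 1 + (Pi.single l 1 - Pi.single b 1) := by abel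
  simp only [dOp, zOp, wshift_mul, wshift_smul, e1, e2, wshift_add, ← add_sub_assoc]
  congr 1
  funext α
  exact dCoeff_mixed ht b k l α

/-- The relations between two rows `u`, `v` of a quantum matrix, in `R`-matrix form: the scalar
`c` is `t` when the two rows are equal and `1` when `u` lies above `v`. -/
def RowRel {A : Type*} [Ring A] [Algebra K A] (t c : K) (u v : Fin N → A) : Prop :=
  ∀ k l, c • (u k * v l) = eqWeight t k l • (v l * u k) + ltWeight t k l • (v k * u l)

theorem zOp_rowRel {t : K} (ht : t ≠ 0) (r : ℕ) : RowRel t t (zOp (N := N) t r) (zOp t r) := by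
  intro k l
  have e1 : (Pi.single l 1 + Pi.single k 1 : Fin N → ℤ) = Pi.single k 1 + Pi.single l 1 :=
    add_comm _ _
  simp only [zOp, wshift_mul, wshift_smul, e1, wshift_add]
  congr 1
  funext α
  exact expBelow_comm ht k l α

/-- Relations between rows are preserved by right multiplication with a matrix `D` whose
entries satisfy the RTT relations and commute with the entries of the rows. -/
theorem RowRel.mul_matrix {A : Type*} [Ring A] [Algebra K A] {t c : K} {u v : Fin N → A}
    {D : Fin N → Fin N → A} (h : RowRel t c u v)
    (hD : ∀ a b k l, eqWeight t a b • (D a k * D b l) + ltWeight t b a • (D b k * D a l) =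
      eqWeight t k l • (D b l * D a k) + ltWeight t k l • (D b k * D a l))
    (hu : ∀ a b k, Commute (D a k) (u b)) (hv : ∀ a b k, Commute (D a k) (v b)) :
    RowRel t c (fun k => ∑ a, u a * D a k) (fun k => ∑ a, v a * D a k) := by
  intro k l
  have swap : ∀ (x y : Fin N → A), (∀ a b k, Commute (D a k) (y b)) → ∀ k l,
      (∑ a, x a * D a k) * (∑ b, y b * D b l) =
        ∑ a, ∑ b, x a * y b * (D a k * D b l) := by
    intro x y hy k l
    rw [Finset.sum_mul_sum]
    refine Finset.sum_congr rfl fun a _ => Finset.sum_congr rfl fun b _ => ?_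
    rw [mul_assoc, ← mul_assoc (D a k), (hy a b k).eq]
    simp only [mul_assoc]
  simp only [swap u v hv, swap v u hu]
  have lhs : c • ∑ a, ∑ b, u a * v b * (D a k * D b l) =
      ∑ b, ∑ a, v b * u a *
        (eqWeight t a b • (D a k * D b l) + ltWeight t b a • (D b k * D a l)) := by
    have : ∀ a b, c • (u a * v b * (D a k * D b l)) =
        eqWeight t a b • (v b * u a * (D a k * D b l)) +
          ltWeight t a b • (v a * u b * (D a k * D b l)) := by
      intro a b
      rw [← smul_mul_assoc, h a b, add_mul, smul_mul_assoc, smul_mul_assoc]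
    simp only [Finset.smul_sum, this, Finset.sum_add_distrib, mul_add, mul_smul_comm]
    congr 1
    exact Finset.sum_comm
  rw [lhs]
  simp only [hD, mul_add, Finset.sum_add_distrib, Finset.smul_sum, mul_smul_comm]

/-- The row obtained from `z` on the copy `s + n` by multiplying with the matrices `D` on the
copies `s + n - 1, …, s`. -/
def rowOp (t : K) : ℕ → ℕ → Fin N → Module.End K (Fock K N)
  | s, 0 => zOp t s
  | s, n + 1 => fun k => ∑ b, rowOp t (s + 1) n b * dOp t s b k

theorem wshift_commute_rowOp (t : K) (n : ℕ) {r s : ℕ} (h : r < s) (σ : Fin N → ℤ)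
    (c : (Fin N → ℤ) → K) (k : Fin N) : Commute (wshift r σ c) (rowOp t s n k) := by
  induction n generalizing s k with
  | zero =>
    rw [rowOp, zOp]
    exact wshift_commute h.ne _ _ _ _
  | succ n ih =>
    rw [rowOp]
    refine Commute.sum_right _ _ _ fun b _ => (ih (h.trans s.lt_succ_self) b).mul_right ?_
    rw [dOp]
    exact wshift_commute h.ne _ _ _ _

theorem rowOp_rowRel_self {t : K} (ht : t ≠ 0) (s n : ℕ) :
    RowRel t t (rowOp (N := N) t s n) (rowOp t s n) := by
  induction n generalizing s with
  | zero => exact zOp_rowRel ht s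
  | succ n ih =>
    exact (ih (s + 1)).mul_matrix (dOp_rtt ht s)
      (fun _ _ _ => wshift_commute_rowOp t n s.lt_succ_self _ _ _)
      (fun _ _ _ => wshift_commute_rowOp t n s.lt_succ_self _ _ _)

theorem rowOp_rowRel_of_lt {t : K} (ht : t ≠ 0) (s : ℕ) {m n : ℕ} (h : m < n) :
    RowRel t 1 (rowOp (N := N) t s m) (rowOp t s n) := by
  induction m generalizing s n with
  | zero =>
    obtain ⟨n, rfl⟩ := Nat.exists_eq_succ_of_ne_zero h.ne'
    intro k l
    have hc : ∀ b k : Fin N, zOp t s k * rowOp t (s + 1) n b = rowOp t (s + 1) n b * zOp t s k :=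
      fun b k => (wshift_commute_rowOp t n s.lt_succ_self _ _ _).eq
    simp only [rowOp, one_smul, Finset.mul_sum, Finset.sum_mul, Finset.smul_sum,
      ← Finset.sum_add_distrib]
    refine Finset.sum_congr rfl fun b _ => ?_
    rw [← mul_assoc, hc, mul_assoc, zOp_dOp ht, mul_add, mul_smul_comm, mul_smul_comm,
      mul_assoc, mul_assoc]
  | succ m ih =>
    obtain ⟨n, rfl⟩ := Nat.exists_eq_succ_of_ne_zero (Nat.ne_zero_of_lt h)
    exact (ih (s + 1) (Nat.lt_of_succ_lt_succ h)).mul_matrix (dOp_rtt ht s)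
      (fun _ _ _ => wshift_commute_rowOp t m s.lt_succ_self _ _ _)
      (fun _ _ _ => wshift_commute_rowOp t n s.lt_succ_self _ _ _)

theorem dOp_single_of_eq_zero (t : K) {s : ℕ} {α : ℕ → Fin N → ℤ} (h : α s = 0)
    (b k : Fin N) :
    dOp t s b k (Finsupp.single α 1) = if b = k then Finsupp.single α 1 else 0 := by
  by_cases hb : b = k
  · subst hb
    have hα : Function.update α s 0 = α := by rw [← h, Function.update_eq_self]
    simp [dOp, h, dCoeff, expAt, hα]
  · simp [dOp, h, dCoeff, expAt, hb]

theorem rowOp_single (t : K) (s n : ℕ) {α : ℕ → Fin N → ℤ}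
    (h : ∀ r, s ≤ r → r < s + n → α r = 0) (k : Fin N) (hk : ∀ i < k, α (s + n) i = 0) :
    rowOp t s n k (Finsupp.single α 1) =
      Finsupp.single (α + Pi.single (s + n) (Pi.single k 1)) 1 := by
  induction n generalizing s with
  | zero =>
    have h0 : ∑ i ∈ Finset.Iio k, α s i = 0 :=
      Finset.sum_eq_zero fun i hi => hk i (Finset.mem_Iio.1 hi)
    have : Function.update α s (α s + Pi.single k 1) = α + Pi.single s (Pi.single k 1) := by
      funext r
      by_cases hr : r = s
      · subst hr; simp
      · simp [hr]
    rw [add_zero, rowOp, zOp, wshift_single, this, expBelow, h0, neg_zero, zpow_zero, one_mul]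
  | succ n ih =>
    have e : s + (n + 1) = s + 1 + n := by omega
    rw [e] at hk ⊢
    have h0 : α s = 0 := h s le_rfl (by omega)
    rw [← ih (s + 1) (fun r h1 h2 => h r (by omega) (by omega)) hk]
    rw [rowOp, LinearMap.sum_apply, Finset.sum_eq_single k]
    · rw [Module.End.mul_apply, dOp_single_of_eq_zero t h0, if_pos rfl]
    · intro b _ hb
      rw [Module.End.mul_apply, dOp_single_of_eq_zero t h0, if_neg hb, map_zero]
    · simp

section relations

variable {A : Type*} [Ring A] [Algebra K A] {t : K} {u v : Fin N → A} {k l : Fin N}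

theorem RowRel.mul_eq_smul_of_self (ht : t ≠ 0) (h : RowRel t t u u) (hkl : k < l) :
    u k * u l = t • (u l * u k) := by
  have := h k l
  simp only [eqWeight, hkl.ne, if_false, ltWeight, hkl, if_true, one_smul, sub_smul] at this
  have h2 : u l * u k = t⁻¹ • (u k * u l) := by
    rw [← sub_eq_zero] at this ⊢
    rw [← neg_eq_zero, ← this]
    abel
  rw [h2, smul_inv_smul₀ ht]

theorem RowRel.mul_eq_smul (h : RowRel t 1 u v) (k : Fin N) :
    u k * v k = t • (v k * u k) := by
  simpa [eqWeight, ltWeight] using h k k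

theorem RowRel.mul_comm_of_lt (h : RowRel t 1 u v) (hkl : k < l) :
    u l * v k = v k * u l := by
  simpa [eqWeight, ltWeight, hkl.ne', hkl.not_gt] using h l k

theorem RowRel.mul_eq_add (h : RowRel t 1 u v) (hkl : k < l) :
    u k * v l = v l * u k + (t - t⁻¹) • (u l * v k) := by
  rw [h.mul_comm_of_lt hkl]
  simpa [eqWeight, ltWeight, hkl.ne, hkl] using h k l

end relations

theorem q_ne_zero : q ≠ 0 := RatFunc.X_ne_zero

/-- The representation of the FRT algebra on the Fock space. -/
def fockRep (N : ℕ) : FRT N →ₐ[F] Module.End F (Fock F N) :=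
  RingQuot.liftAlgHom F
    ⟨FreeAlgebra.lift F fun p => rowOp q 0 p.1 p.2, fun x y h => by
      induction h with
      | row i k l hkl =>
        simpa [Xgen] using (rowOp_rowRel_self q_ne_zero 0 i).mul_eq_smul_of_self q_ne_zero hkl
      | col i j k hij =>
        simpa [Xgen] using (rowOp_rowRel_of_lt q_ne_zero 0 hij).mul_eq_smul k
      | anti i j k l hij hkl =>
        simpa [Xgen] using (rowOp_rowRel_of_lt q_ne_zero 0 hij).mul_comm_of_lt hkl
      | main i j k l hij hkl =>
        simpa [Xgen] using (rowOp_rowRel_of_lt q_ne_zero 0 hij).mul_eq_add hkl⟩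

@[simp]
theorem fockRep_xg (i j : Fin N) : fockRep N (xg N i j) = rowOp q 0 i j := by
  rw [fockRep, xg, RingQuot.liftAlgHom_mkAlgHom_apply, Xgen, FreeAlgebra.lift_ι_apply]

/-- The monomial in the FRT algebra attached to a list of index pairs. -/
abbrev monomial (l : List (Fin N × Fin N)) : FRT N := (l.map fun p => xg N p.1 p.2).prod

theorem monomial_cons (p : Fin N × Fin N) (l : List (Fin N × Fin N)) :
    monomial (p :: l) = xg N p.1 p.2 * monomial l := by
  rw [monomial, List.map_cons, List.prod_cons]

theorem monomial_append (l l' : List (Fin N × Fin N)) :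
    monomial (l ++ l') = monomial l * monomial l' := by
  rw [monomial, List.map_append, List.prod_append]

/-- The sequence of exponents of a monomial, row by row. -/
def exponents : List (Fin N × Fin N) → ℕ → Fin N → ℤ
  | [] => 0
  | p :: l => exponents l + Pi.single (p.1 : ℕ) (Pi.single p.2 1 : Fin N → ℤ)

theorem exponents_apply (l : List (Fin N × Fin N)) (p : Fin N × Fin N) :
    exponents l p.1 p.2 = l.count p := by
  induction l with
  | nil => simp [exponents]
  | cons r l ih =>
    rw [exponents, Pi.add_apply, Pi.add_apply, ih, List.count_cons]
    by_cases h1 : r.1 = p.1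
    · by_cases h2 : r.2 = p.2
      · have : r = p := Prod.ext h1 h2
        subst this
        simp
      · have : r ≠ p := fun h => h2 (congrArg _ h)
        simp [h1, this, Ne.symm h2]
    · have h3 : (p.1 : ℕ) ≠ r.1 := fun h => h1 (Fin.ext h.symm)
      have : r ≠ p := fun h => h1 (congrArg _ h)
      simp [this, h3]

theorem exponents_eq_zero (l : List (Fin N × Fin N)) {r : ℕ} {k : Fin N}
    (h : ∀ p ∈ l, (p.1 : ℕ) = r → p.2 ≠ k) : exponents l r k = 0 := by
  induction l with
  | nil => rfl
  | cons p l ih =>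
    rw [exponents, Pi.add_apply, Pi.add_apply, ih fun p hp => h p (List.mem_cons_of_mem _ hp),
      zero_add]
    by_cases h1 : (p.1 : ℕ) = r
    · have := h p List.mem_cons_self h1
      simp [h1, this.symm]
    · simp [Ne.symm h1]

/-- The lexicographic order on index pairs. -/
abbrev LexLE (p r : Fin N × Fin N) : Prop := p.1 < r.1 ∨ (p.1 = r.1 ∧ p.2 ≤ r.2)

theorem pairwise_of_mem_orderedFRT {l : List (Fin N × Fin N)} (h : l ∈ orderedFRT N) :
    l.Pairwise LexLE := by
  have : Trans (LexLE (N := N)) LexLE LexLE := ⟨fun {a b c} h1 h2 => by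
    simp only [LexLE] at *
    omega⟩
  exact List.isChain_iff_pairwise.1 h

theorem fockRep_monomial {l : List (Fin N × Fin N)} (h : l.Pairwise LexLE) :
    fockRep N (monomial l) (Finsupp.single 0 1) = Finsupp.single (exponents l) 1 := by
  induction l with
  | nil => simp [monomial, exponents]
  | cons p l ih =>
    rw [List.pairwise_cons] at h
    rw [monomial_cons, map_mul, Module.End.mul_apply, ih h.2,
      fockRep_xg, rowOp_single, exponents, zero_add]
    · intro r _ hr
      funext k
      refine exponents_eq_zero _ fun s hs he => ?_
      have := h.1 s hs
      omega
    · intro i hi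
      rw [zero_add]
      refine exponents_eq_zero _ fun s hs he => ?_
      have := h.1 s hs
      omega

theorem exponents_injOn :
    Function.Injective fun l : orderedFRT N => exponents (l : List (Fin N × Fin N)) := by
  intro l l' h
  refine Subtype.ext (List.Perm.eq_of_pairwise (le := LexLE) ?_
    (pairwise_of_mem_orderedFRT l.2) (pairwise_of_mem_orderedFRT l'.2) ?_)
  · intro a b _ _ h1 h2
    exact Prod.ext (by omega) (by omega)
  · refine List.perm_iff_count.2 fun p => ?_
    have := congrFun (congrFun h p.1) p.2
    simpa only [exponents_apply, Nat.cast_inj] using this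

theorem linearIndependent_monomial :
    LinearIndependent F fun l : orderedFRT N => monomial (l : List (Fin N × Fin N)) := by
  refine LinearIndependent.of_comp
    ((LinearMap.applyₗ (Finsupp.single 0 1 : Fock F N)).comp (fockRep N).toLinearMap) ?_
  have : (((LinearMap.applyₗ (Finsupp.single 0 1 : Fock F N)).comp (fockRep N).toLinearMap) ∘
      fun l : orderedFRT N => monomial (l : List (Fin N × Fin N))) =
      (fun α => Finsupp.single α (1 : F)) ∘
        fun l : orderedFRT N => exponents (l : List (Fin N × Fin N)) := by
    funext l
    exact fockRep_monomial (pairwise_of_mem_orderedFRT l.2)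
  rw [this]
  exact (Finsupp.linearIndependent_single_one F _).comp _ exponents_injOn

/-- The number of an index pair in the lexicographic order. -/
def pairCode (p : Fin N × Fin N) : ℕ := p.1 * N + p.2

theorem pairCode_lt_pairCode {p r : Fin N × Fin N} (h : ¬ LexLE r p) : pairCode p < pairCode r := by
  have h2 := p.2.isLt
  unfold pairCode
  rcases lt_trichotomy p.1 r.1 with h1 | h1 | h1
  · have : ((p.1 : ℕ) + 1) * N ≤ r.1 * N := Nat.mul_le_mul_right _ h1
    linarith
  · rw [h1]
    simp only [LexLE] at h
    omega
  · exact absurd (Or.inl h1) h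

theorem pairCode_lt (p : Fin N × Fin N) : pairCode p < N * N := by
  have h1 : ((p.1 : ℕ) + 1) * N ≤ N * N := Nat.mul_le_mul_right _ p.1.isLt
  have h2 := p.2.isLt
  unfold pairCode
  linarith

/-- A number whose size reflects the lexicographic order on words of a given length. -/
def wordCode : List (Fin N × Fin N) → ℕ
  | [] => 0
  | p :: l => pairCode p * (N * N) ^ l.length + wordCode l

theorem wordCode_append_lt {l l' : List (Fin N × Fin N)} (hl : l.length = l'.length)
    (h : wordCode l < wordCode l') (w : List (Fin N × Fin N)) :
    wordCode (w ++ l) < wordCode (w ++ l') := by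
  induction w with
  | nil => exact h
  | cons p w ih =>
    simp only [List.cons_append, wordCode, List.length_append, hl]
    omega

theorem wordCode_swap_lt {a b a' b' : Fin N × Fin N} (h : pairCode a' < pairCode a)
    (w s : List (Fin N × Fin N)) :
    wordCode (w ++ a' :: b' :: s) < wordCode (w ++ a :: b :: s) := by
  refine wordCode_append_lt (by simp) ?_ w
  have hb := pairCode_lt b'
  have hN : 0 < N * N := (Nat.zero_le _).trans_lt hb
  have hP : 0 < (N * N) ^ s.length := pow_pos hN _
  simp only [wordCode, List.length_cons, pow_succ]
  generalize (N * N) ^ s.length = P at *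
  have h1 : (pairCode a' + 1) * (P * (N * N)) ≤ pairCode a * (P * (N * N)) :=
    Nat.mul_le_mul_right _ h
  have h2 : (pairCode b' + 1) * P ≤ N * N * P := Nat.mul_le_mul_right _ hb
  nlinarith

/-- A product of two generators in the wrong order is a combination of products of two
generators with a smaller first factor. -/
theorem xg_mul_xg_mem_span {a b : Fin N × Fin N} (h : ¬ LexLE a b) :
    xg N a.1 a.2 * xg N b.1 b.2 ∈ Submodule.span F
      {x | ∃ a' b' : Fin N × Fin N, pairCode a' < pairCode a ∧
        x = xg N a'.1 a'.2 * xg N b'.1 b'.2} := by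
  have mem : ∀ i k j l, pairCode (i, k) < pairCode a →
      xg N i k * xg N j l ∈ Submodule.span F
        {x | ∃ a' b' : Fin N × Fin N, pairCode a' < pairCode a ∧
          x = xg N a'.1 a'.2 * xg N b'.1 b'.2} :=
    fun i k j l hc => Submodule.subset_span ⟨(i, k), (j, l), hc, rfl⟩
  have hab := mem b.1 b.2 a.1 a.2 (pairCode_lt_pairCode h)
  obtain ⟨j, l⟩ := a
  obtain ⟨i, k⟩ := b
  simp only [LexLE, not_or, not_and, not_lt, not_le] at h hab ⊢
  rcases h.1.lt_or_eq with hij | rfl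
  · rcases lt_trichotomy k l with hkl | rfl | hkl
    · have e : xg N i k * xg N j l =
          xg N j l * xg N i k + (q - q⁻¹) • (xg N i l * xg N j k) := by
        simpa [xg] using RingQuot.mkAlgHom_rel F (FRTrel.main i j k l hij hkl)
      rw [← sub_eq_iff_eq_add] at e
      rw [← e]
      refine Submodule.sub_mem _ hab (Submodule.smul_mem _ _ (mem _ _ _ _ ?_))
      exact pairCode_lt_pairCode (by simp only [LexLE]; omega)
    · have e : xg N i k * xg N j k = q • (xg N j k * xg N i k) := by
        simpa [xg] using RingQuot.mkAlgHom_rel F (FRTrel.col i j k hij)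
      rw [← inv_smul_smul₀ q_ne_zero (xg N j k * xg N i k), ← e]
      exact Submodule.smul_mem _ _ hab
    · have e : xg N i k * xg N j l = xg N j l * xg N i k := by
        simpa [xg] using RingQuot.mkAlgHom_rel F (FRTrel.anti i j l k hij hkl)
      rwa [← e]
  · have e : xg N i k * xg N i l = q • (xg N i l * xg N i k) := by
      simpa [xg] using RingQuot.mkAlgHom_rel F (FRTrel.row i k l (h.2 rfl))
    rw [← inv_smul_smul₀ q_ne_zero (xg N i l * xg N i k), ← e]
    exact Submodule.smul_mem _ _ hab

theorem monomial_mem_span (l : List (Fin N × Fin N)) :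
    monomial l ∈ Submodule.span F
      (Set.range fun l : orderedFRT N => monomial (l : List (Fin N × Fin N))) := by
  induction hn : wordCode l using Nat.strong_induction_on generalizing l with
  | _ n ih =>
    by_cases hl : l ∈ orderedFRT N
    · exact Submodule.subset_span ⟨⟨l, hl⟩, rfl⟩
    · have hl' : ¬ l.IsChain LexLE := hl
      rw [List.isChain_iff_forall_rel_of_append_cons_cons] at hl'
      push Not at hl'
      obtain ⟨a, b, w, s, rfl, hab⟩ := hl'
      have key : ∀ x ∈ Submodule.span F
          {x | ∃ a' b' : Fin N × Fin N, pairCode a' < pairCode a ∧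
            x = xg N a'.1 a'.2 * xg N b'.1 b'.2},
          monomial w * x * monomial s ∈ Submodule.span F
            (Set.range fun l : orderedFRT N => monomial (l : List (Fin N × Fin N))) := by
        intro x hx
        induction hx using Submodule.span_induction with
        | mem x hx =>
          obtain ⟨a', b', h, rfl⟩ := hx
          have := ih _ (hn ▸ wordCode_swap_lt h w s) (w ++ a' :: b' :: s) rfl
          simpa [monomial_append, monomial_cons, mul_assoc] using this
        | zero => simp
        | add x y _ _ hx hy =>
          rw [mul_add, add_mul]
          exact add_mem hx hy
        | smul c x _ hx =>
          rw [mul_smul_comm, smul_mul_assoc]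
          exact Submodule.smul_mem _ c hx
      simpa [monomial_append, monomial_cons, mul_assoc] using key _ (xg_mul_xg_mem_span (by simpa [LexLE] using hab))

theorem span_monomial_eq_top :
    Submodule.span F (Set.range (monomial (N := N))) = ⊤ := by
  refine eq_top_iff.2 fun y _ => ?_
  obtain ⟨x, rfl⟩ := RingQuot.mkAlgHom_surjective F (FRTrel N) y
  induction x using FreeAlgebra.induction with
  | grade0 r =>
    rw [AlgHom.commutes, Algebra.algebraMap_eq_smul_one]
    exact Submodule.smul_mem _ _ (Submodule.subset_span ⟨[], rfl⟩)
  | grade1 p => exact Submodule.subset_span ⟨[p], by rw [monomial_cons]; exact mul_one _⟩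
  | add a b ha hb =>
    rw [map_add]
    exact add_mem (ha trivial) (hb trivial)
  | mul a b ha hb =>
    rw [map_mul]
    have h := Submodule.mul_mem_mul (ha trivial) (hb trivial)
    rw [Submodule.span_mul_span] at h
    refine Submodule.span_mono ?_ h
    rintro _ ⟨_, ⟨l, rfl⟩, _, ⟨l', rfl⟩, rfl⟩
    exact ⟨l ++ l', monomial_append l l'⟩

end FRTFock

/-- PBW basis for the FRT algebra.
The ordered monomials `x^{i_1}_{j_1} ⋯ x^{i_r}_{j_r}` (indices weakly increasing in the
lexicographic order; the empty monomial being `1`) form a basis of `Õ_q(Mat_N)` over `F`: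
the family is linearly independent and spans. -/
theorem frt_pbw_basis (N : ℕ) (hN : 1 ≤ N) :
    LinearIndependent F
        (fun l : orderedFRT N => ((l : List (Fin N × Fin N)).map fun p => xg N p.1 p.2).prod) ∧
      Submodule.span F
        (Set.range
          (fun l : orderedFRT N =>
            ((l : List (Fin N × Fin N)).map fun p => xg N p.1 p.2).prod)) = ⊤ := by
  refine ⟨FRTFock.linearIndependent_monomial, eq_top_iff.2 ?_⟩
  rw [← FRTFock.span_monomial_eq_top, Submodule.span_le]
  rintro _ ⟨l, rfl⟩
  exact FRTFock.monomial_mem_span l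

end
end

section
/- Additivity of length: let I = {i_1<…<i_k} and J = {j_1<…<j_k} be subsets of [N] with k ≥ 1, let U ⊆ [N]∖(I∪J), let τ: I → J be a bijection with τ(i_1) = j_m, and let τ_m: I∖{i_1} → J∖{j_m} be the restriction of τ. Then ℓ_U(τ) − ℓ_U(τ_m) = m − 1 + γ_U^{IJ}(m), where γ_U^{IJ}(m) = #{a ∈ U : i_1 < a < j_m or j_m < a < i_1}. -/
open scoped BigOperators

noncomputable section

/-- The exceedance `e(τ) = #{a ∈ I : τ(a) > a}` of a bijection `τ : I → J`
encoded by a function `f : ℕ → ℕ`. -/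
def excN (I : Finset ℕ) (f : ℕ → ℕ) : ℕ := (I.filter fun a => a < f a).card

/-- The length `ℓ_U(τ)` of a bijection `τ : I → J` relative to the auxiliary set `U`:
the number of inversions of the extension `τ̂ : I∪U → J∪U` of `τ` by the identity
(encoded by a function `f : ℕ → ℕ` that is the identity on `U`). -/
def lenN (I U : Finset ℕ) (f : ℕ → ℕ) : ℕ :=
  (((I ∪ U) ×ˢ (I ∪ U)).filter fun p => p.1 < p.2 ∧ f p.2 < f p.1).card

/-- Inserting a new point `x` into `T` creates exactly the inversions of `f` that involve `x`. -/
theorem card_inversions_insert (T : Finset ℕ) (f : ℕ → ℕ) (x : ℕ) (hx : x ∉ T) :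
    ((insert x T ×ˢ insert x T).filter fun p => p.1 < p.2 ∧ f p.2 < f p.1).card =
      ((T ×ˢ T).filter fun p => p.1 < p.2 ∧ f p.2 < f p.1).card +
        (T.filter fun a => (x < a ∧ f a < f x) ∨ (a < x ∧ f x < f a)).card := by
  have hinj : Function.Injective fun a : ℕ => (min x a, max x a) := by
    intro a b h
    simp only [Prod.mk.injEq] at h
    omega
  rw [← Finset.card_image_of_injective (T.filter _) hinj, ← Finset.card_union_of_disjoint]
  · congr 1
    ext ⟨a, b⟩
    simp only [Finset.mem_filter, Finset.mem_product, Finset.mem_insert, Finset.mem_union,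
      Finset.mem_image, Prod.mk.injEq]
    constructor
    · rintro ⟨⟨rfl | ha, rfl | hb⟩, hlt, hf⟩
      · exact absurd hlt (lt_irrefl _)
      · exact Or.inr ⟨b, ⟨hb, Or.inl ⟨hlt, hf⟩⟩, min_eq_left hlt.le, max_eq_right hlt.le⟩
      · exact Or.inr ⟨a, ⟨ha, Or.inr ⟨hlt, hf⟩⟩, min_eq_right hlt.le, max_eq_left hlt.le⟩
      · exact Or.inl ⟨⟨ha, hb⟩, hlt, hf⟩
    · rintro (⟨⟨ha, hb⟩, h⟩ | ⟨c, ⟨hc, ⟨hlt, hf⟩ | ⟨hlt, hf⟩⟩, h1, h2⟩)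
      · exact ⟨⟨Or.inr ha, Or.inr hb⟩, h⟩
      · rw [min_eq_left hlt.le] at h1
        rw [max_eq_right hlt.le] at h2
        subst h1 h2
        exact ⟨⟨Or.inl rfl, Or.inr hc⟩, hlt, hf⟩
      · rw [min_eq_right hlt.le] at h1
        rw [max_eq_left hlt.le] at h2
        subst h1 h2
        exact ⟨⟨Or.inr hc, Or.inl rfl⟩, hlt, hf⟩
  · rw [Finset.disjoint_left]
    rintro ⟨a, b⟩ h h'
    simp only [Finset.mem_filter, Finset.mem_product, Finset.mem_image, Prod.mk.injEq] at h h'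
    obtain ⟨c, -, h1, h2⟩ := h'
    rcases le_total x c with hc | hc
    · exact hx (by rw [min_eq_left hc] at h1; exact h1 ▸ h.1.1)
    · exact hx (by rw [max_eq_left hc] at h2; exact h2 ▸ h.1.2)

/-- additivity of length. Let `I, J ⊆ [N]` with `#I = #J = k ≥ 1`,
let `U ⊆ [N]∖(I∪J)`, let `τ : I → J` be a bijection (encoded by `f`, which is the
identity off `I`), with `τ(i_1) = j_m` where `i_1 = min I`. Then
`ℓ_U(τ) − ℓ_U(τ_m) = m − 1 + γ_U^{IJ}(m)`, where `τ_m : I∖{i_1} → J∖{j_m}` is the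
restriction of `τ`, `m − 1 = #{b ∈ J : b < j_m}`, and
`γ_U^{IJ}(m) = #{a ∈ U : i_1 < a < j_m or j_m < a < i_1}`. -/
theorem length_additivity (N k : ℕ) (I J U : Finset ℕ)
    (hIN : I ⊆ Finset.Icc 1 N) (hJN : J ⊆ Finset.Icc 1 N) (hUN : U ⊆ Finset.Icc 1 N)
    (hU : ∀ a ∈ U, a ∉ I ∧ a ∉ J)
    (hk : 1 ≤ k) (hI : I.card = k) (hJ : J.card = k)
    (f : ℕ → ℕ) (hmap : ∀ a ∈ I, f a ∈ J)
    (hinj : ∀ a ∈ I, ∀ b ∈ I, f a = f b → a = b)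
    (hsurj : ∀ b ∈ J, ∃ a ∈ I, f a = b)
    (hfix : ∀ a, a ∉ I → f a = a)
    (i1 : ℕ) (hi1 : i1 ∈ I ∧ ∀ a ∈ I, i1 ≤ a) :
    lenN I U f =
      lenN (I.erase i1) U f + (J.filter (· < f i1)).card +
        (U.filter fun a => (i1 < a ∧ a < f i1) ∨ (f i1 < a ∧ a < i1)).card := by
  obtain ⟨hmem, hmin⟩ := hi1
  have hnot : i1 ∉ I.erase i1 ∪ U := by
    simpa using fun h => (hU i1 h).1 hmem
  have hins : I ∪ U = insert i1 (I.erase i1 ∪ U) := by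
    rw [← Finset.insert_union, Finset.insert_erase hmem]
  have hdisj : Disjoint (I.erase i1) U :=
    Finset.disjoint_left.2 fun a ha h => (hU a h).1 (Finset.mem_of_mem_erase ha)
  have hJcard : ((I.erase i1).filter fun a =>
      (i1 < a ∧ f a < f i1) ∨ (a < i1 ∧ f i1 < f a)).card = (J.filter (· < f i1)).card := by
    refine Finset.card_bij (fun a _ => f a) ?_ ?_ ?_
    · intro a ha
      simp only [Finset.mem_filter, Finset.mem_erase] at ha ⊢
      have := hmin a ha.1.2
      exact ⟨hmap a ha.1.2, by omega⟩
    · intro a ha b hb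
      simp only [Finset.mem_filter, Finset.mem_erase] at ha hb
      exact hinj a ha.1.2 b hb.1.2
    · intro b hb
      simp only [Finset.mem_filter] at hb
      obtain ⟨a, ha, rfl⟩ := hsurj b hb.1
      have hne : a ≠ i1 := by
        rintro rfl
        exact lt_irrefl _ hb.2
      refine ⟨a, ?_, rfl⟩
      simp only [Finset.mem_filter, Finset.mem_erase]
      exact ⟨⟨hne, ha⟩, Or.inl ⟨lt_of_le_of_ne (hmin a ha) hne.symm, hb.2⟩⟩
  have hUfilter : (U.filter fun a => (i1 < a ∧ f a < f i1) ∨ (a < i1 ∧ f i1 < f a)) =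
      U.filter fun a => (i1 < a ∧ a < f i1) ∨ (f i1 < a ∧ a < i1) := by
    refine Finset.filter_congr fun a ha => ?_
    rw [hfix a (hU a ha).1, and_comm (a := a < i1)]
  unfold lenN
  rw [hins, card_inversions_insert _ f i1 hnot, Finset.filter_union,
    Finset.card_union_of_disjoint (Finset.disjoint_filter_filter hdisj), hJcard, hUfilter,
    add_assoc]

end
end

section
/- Bijection of expansion cliques: let I,J ⊆ [N] with #I = #J = m < k ≤ N. For (I',J') ∈ Cl_k(I,J) write I' = {i'_1<…<i'_{k−m}} and J' = {j'_1<…<j'_{k−m}} in increasing order. Then the map β sending a pair (m', (I',J')) with 1 ≤ m' ≤ k−m and (I',J') ∈ Cl_k(I,J) to the triple (s, t, (I'', J'')) = (i'_1, j'_{m'}, (I'∖{i'_1}, J'∖{j'_{m'}})) is a well-defined bijection from {1,…,k−m} × Cl_k(I,J) onto the set of triples (s, t, (I'',J'')) such that s ∈ [N] satisfies s > i for all i ∈ I, t ∈ [N]∖J, and (I'',J'') ∈ Cl_k(I∪{s}, J∪{t}). -/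
open scoped BigOperators

noncomputable section

/-- The expansion clique `Cl_k(I,J)`: pairs `(I',J')` of subsets of `[N]` with
`I' ⊆ {a ∈ [N] : a > i for all i ∈ I}`, `#I' = #J' = k − #I`, and `I∪I' = J∪J'`. -/
def Cl (N k : ℕ) (I J : Finset ℕ) : Set (Finset ℕ × Finset ℕ) :=
  {P | P.1 ⊆ Finset.Icc 1 N ∧ P.2 ⊆ Finset.Icc 1 N ∧
    (∀ a ∈ P.1, ∀ i ∈ I, i < a) ∧
    P.1.card = k - I.card ∧ P.2.card = k - I.card ∧ I ∪ P.1 = J ∪ P.2}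

/-- The `m`-th smallest element of a finite set of naturals (1-based), `0` if out of
range. -/
def nthEl (J : Finset ℕ) (m : ℕ) : ℕ := (J.sort (· ≤ ·)).getD (m - 1) 0

theorem nthEl_eq_getElem {J : Finset ℕ} {m : ℕ} (h : m - 1 < (J.sort (· ≤ ·)).length) :
    nthEl J m = (J.sort (· ≤ ·))[m - 1] := by
  rw [nthEl, List.getD_eq_getElem]

theorem nthEl_mem {J : Finset ℕ} {m : ℕ} (h1 : 1 ≤ m) (h2 : m ≤ J.card) : nthEl J m ∈ J := by
  have h : m - 1 < (J.sort (· ≤ ·)).length := by rw [Finset.length_sort]; omega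
  rw [nthEl_eq_getElem h, ← Finset.mem_sort (· ≤ ·)]
  exact List.getElem_mem h

theorem nthEl_injOn {J : Finset ℕ} {m n : ℕ} (hm1 : 1 ≤ m) (hm2 : m ≤ J.card) (hn1 : 1 ≤ n)
    (hn2 : n ≤ J.card) (h : nthEl J m = nthEl J n) : m = n := by
  have hm : m - 1 < (J.sort (· ≤ ·)).length := by rw [Finset.length_sort]; omega
  have hn : n - 1 < (J.sort (· ≤ ·)).length := by rw [Finset.length_sort]; omega
  rw [nthEl_eq_getElem hm, nthEl_eq_getElem hn, (J.sort_nodup (· ≤ ·)).getElem_inj_iff] at h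
  omega

theorem exists_nthEl_eq {J : Finset ℕ} {t : ℕ} (h : t ∈ J) :
    ∃ m, 1 ≤ m ∧ m ≤ J.card ∧ nthEl J m = t := by
  rw [← Finset.mem_sort (· ≤ ·)] at h
  obtain ⟨i, hi, rfl⟩ := List.getElem_of_mem h
  refine ⟨i + 1, by omega, by rw [Finset.length_sort] at hi; omega, ?_⟩
  exact nthEl_eq_getElem (m := i + 1) hi

theorem nthEl_one_le {J : Finset ℕ} {a : ℕ} (h : a ∈ J) : nthEl J 1 ≤ a := by
  rw [← Finset.mem_sort (· ≤ ·)] at h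
  obtain ⟨i, hi, rfl⟩ := List.getElem_of_mem h
  rw [nthEl_eq_getElem (m := 1) (by omega)]
  exact (J.pairwise_sort (· ≤ ·)).sortedLE.getElem_le_getElem_of_le (Nat.zero_le i)

theorem nthEl_one_insert {J : Finset ℕ} {s : ℕ} (h : ∀ a ∈ J, s < a) :
    nthEl (insert s J) 1 = s := by
  refine le_antisymm (nthEl_one_le (Finset.mem_insert_self s J)) ?_
  rcases Finset.mem_insert.1 (nthEl_mem (J := insert s J) le_rfl
    (Finset.card_pos.2 ⟨s, Finset.mem_insert_self s J⟩)) with h' | h'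
  · exact h'.ge
  · exact (h _ h').le

/-- If `J` and `J'` cover a disjoint union of sets of the same sizes, they are disjoint. -/
theorem disjoint_of_union_eq {I J I' J' : Finset ℕ} (hd : Disjoint I I') (hc : I.card = J.card)
    (hc' : I'.card = J'.card) (h : I ∪ I' = J ∪ J') : Disjoint J J' := by
  rw [← Finset.card_union_eq_card_add_card, ← h, Finset.card_union_of_disjoint hd, hc, hc']

theorem Cl.disjoint {N k : ℕ} {I J : Finset ℕ} {P : Finset ℕ × Finset ℕ} (h : P ∈ Cl N k I J)
    (hc : I.card = J.card) : Disjoint I P.1 ∧ Disjoint J P.2 := by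
  obtain ⟨-, -, hlt, h1, h2, hu⟩ := h
  have hd : Disjoint I P.1 :=
    Finset.disjoint_left.2 fun a ha ha' => (hlt a ha' a ha).false
  exact ⟨hd, disjoint_of_union_eq hd hc (h1.trans h2.symm) hu⟩

/-- bijection of expansion cliques. For `#I = #J = m < k ≤ N`, the
map `β : (m', (I',J')) ↦ (i'_1, j'_{m'}, (I'∖{i'_1}, J'∖{j'_{m'}}))` is a bijection
from `{1,…,k−m} × Cl_k(I,J)` onto the set of triples `(s,t,(I'',J''))` with `s ∈ [N]`,
`s > i` for all `i ∈ I`, `t ∈ [N]∖J`, and `(I'',J'') ∈ Cl_k(I∪{s}, J∪{t})`. -/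
theorem clique_bijection (N k : ℕ) (hN : 1 ≤ N) (hk : k ≤ N) (I J : Finset ℕ)
    (hIN : I ⊆ Finset.Icc 1 N) (hJN : J ⊆ Finset.Icc 1 N)
    (hcard : I.card = J.card) (hm : I.card < k) :
    Set.BijOn
      (fun p : ℕ × (Finset ℕ × Finset ℕ) =>
        ((nthEl p.2.1 1, nthEl p.2.2 p.1),
          (p.2.1.erase (nthEl p.2.1 1), p.2.2.erase (nthEl p.2.2 p.1))))
      {p : ℕ × (Finset ℕ × Finset ℕ) | 1 ≤ p.1 ∧ p.1 ≤ k - I.card ∧ p.2 ∈ Cl N k I J}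
      {x : (ℕ × ℕ) × (Finset ℕ × Finset ℕ) |
        x.1.1 ∈ Finset.Icc 1 N ∧ (∀ i ∈ I, i < x.1.1) ∧
          x.1.2 ∈ Finset.Icc 1 N ∧ x.1.2 ∉ J ∧
          x.2 ∈ Cl N k (insert x.1.1 I) (insert x.1.2 J)} := by
  refine ⟨?_, ?_, ?_⟩
  · rintro ⟨m, I', J'⟩ ⟨h1, h2, hP⟩
    obtain ⟨hdI, hdJ⟩ := Cl.disjoint hP hcard
    obtain ⟨hI', hJ', hlt, hcI, hcJ, hu⟩ := hP
    dsimp only at *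
    have hs : nthEl I' 1 ∈ I' := nthEl_mem le_rfl (by omega)
    have ht : nthEl J' m ∈ J' := nthEl_mem h1 (by omega)
    have hsI : nthEl I' 1 ∉ I := Finset.disjoint_right.1 hdI hs
    have htJ : nthEl J' m ∉ J := Finset.disjoint_right.1 hdJ ht
    refine ⟨hI' hs, hlt _ hs, hJ' ht, htJ, (Finset.erase_subset _ _).trans hI',
      (Finset.erase_subset _ _).trans hJ', ?_, ?_, ?_, ?_⟩
    · intro a ha i hi
      obtain ⟨hne, ha⟩ := Finset.mem_erase.1 ha
      rcases Finset.mem_insert.1 hi with rfl | hi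
      · exact lt_of_le_of_ne (nthEl_one_le ha) hne.symm
      · exact hlt a ha i hi
    · rw [Finset.card_erase_of_mem hs, Finset.card_insert_of_notMem hsI]
      omega
    · rw [Finset.card_erase_of_mem ht, Finset.card_insert_of_notMem hsI]
      omega
    · rw [Finset.insert_union, ← Finset.union_insert, Finset.insert_erase hs, hu,
        Finset.insert_union, ← Finset.union_insert, Finset.insert_erase ht]
  · rintro ⟨m, I₁, J₁⟩ ⟨h1, h2, hP⟩ ⟨n, I₂, J₂⟩ ⟨h3, h4, hQ⟩ h
    obtain ⟨-, -, -, hcI, hcJ, -⟩ := hP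
    obtain ⟨-, -, -, hcI', hcJ', -⟩ := hQ
    simp only [Prod.mk.injEq] at *
    obtain ⟨⟨hs, ht⟩, hI, hJ⟩ := h
    have hI₁ : I₁ = I₂ := by
      rw [← Finset.insert_erase (nthEl_mem (J := I₁) le_rfl (by omega)), hI, hs,
        Finset.insert_erase (nthEl_mem le_rfl (by omega))]
    have hJ₁ : J₁ = J₂ := by
      rw [← Finset.insert_erase (nthEl_mem (J := J₁) h1 (by omega)), hJ, ht,
        Finset.insert_erase (nthEl_mem h3 (by omega))]
    subst hJ₁
    exact ⟨nthEl_injOn h1 (by omega) h3 (by omega) ht, hI₁, rfl⟩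
  · rintro ⟨⟨s, t⟩, I', J'⟩ ⟨hsN, hsI, htN, htJ, hP⟩
    dsimp only at *
    have hsI' : s ∉ I := fun h => (hsI s h).false
    obtain ⟨hdI, hdJ⟩ := Cl.disjoint hP (by
      rw [Finset.card_insert_of_notMem hsI', Finset.card_insert_of_notMem htJ, hcard])
    obtain ⟨hI', hJ', hlt, hcI, hcJ, hu⟩ := hP
    dsimp only at *
    rw [Finset.card_insert_of_notMem hsI'] at hcI hcJ
    have hs : s ∉ I' := Finset.disjoint_left.1 hdI (Finset.mem_insert_self s I)
    have ht : t ∉ J' := Finset.disjoint_left.1 hdJ (Finset.mem_insert_self t J)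
    have hcs : (insert s I').card = k - I.card := by
      rw [Finset.card_insert_of_notMem hs]; omega
    have hct : (insert t J').card = k - I.card := by
      rw [Finset.card_insert_of_notMem ht]; omega
    obtain ⟨m, h1, h2, hmt⟩ := exists_nthEl_eq (Finset.mem_insert_self t J')
    have hm1 : nthEl (insert s I') 1 = s :=
      nthEl_one_insert fun a ha => hlt a ha s (Finset.mem_insert_self s I)
    refine ⟨(m, (insert s I', insert t J')), ⟨h1, hct ▸ h2, Finset.insert_subset hsN hI',
      Finset.insert_subset htN hJ', ?_, hcs, hct, ?_⟩, ?_⟩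
    · intro a ha i hi
      rcases Finset.mem_insert.1 ha with rfl | ha
      · exact hsI i hi
      · exact hlt a ha i (Finset.mem_insert_of_mem hi)
    · rw [Finset.union_insert, ← Finset.insert_union, hu, Finset.insert_union,
        ← Finset.union_insert]
    · simp only [hm1, hmt, Finset.erase_insert hs, Finset.erase_insert ht]

end
end

section
/- Telescoping lemma: let I,J ⊆ [N] with #I = #J ≤ k−1, let s ∈ [N] satisfy s > i for all i ∈ I, let t ∈ [N]∖J with s < t, let (I'',J'') ∈ Cl_k(I∪{s}, J∪{t}) with t ∈ I'', and set U = [N]∖(I∪{s}∪I''). For r ∈ (s,t]∖I'' define Y(r) = X(s,r) + ℓ_{U∖{r}}(τ_r) + #{a ∈ (I''∖{t})∪{r} : r < a < t}, where X(s,r) = |r−s| + ind_{I∪{s}}(s) − ind_{J∪{r}}(r) − 2·#{i ∈ I : min(s,r) ≤ i ≤ max(s,r)} and τ_r: (I''∖{t})∪{r} → J'' is the unique order-preserving bijection. If r < r' both lie in (s,t]∖I'' and no element of (s,t]∖I'' lies strictly between r and r', then Y(r') − Y(r) = 2. -/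
open scoped BigOperators

noncomputable section

/-- `ind_K(r) = #{a ∈ K∪{r} : a ≤ r}`. -/
def indN (K : Finset ℕ) (r : ℕ) : ℕ := ((insert r K).filter (· ≤ r)).card

/-- The unique order-preserving bijection `K → L` (for `#K = #L`), encoded as a
function `ℕ → ℕ` equal to the identity off `K`. -/
def ordBij (K L : Finset ℕ) : ℕ → ℕ := fun a => if a ∈ K then nthEl L (indN K a) else a

/-- `X(s,r) = |r−s| + ind_{I∪{s}}(s) − ind_{J∪{r}}(r) − 2·#{i ∈ I : min(s,r) ≤ i ≤ max(s,r)}`. -/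
def Xqty (I J : Finset ℕ) (s r : ℕ) : ℤ :=
  |(r : ℤ) - (s : ℤ)| + (indN (insert s I) s : ℤ) - (indN (insert r J) r : ℤ) -
    2 * ((I.filter fun i => min s r ≤ i ∧ i ≤ max s r).card : ℤ)

/-- `Y(r) = X(s,r) + ℓ_{U∖{r}}(τ_r) + #{a ∈ (I''∖{t})∪{r} : r < a < t}`, where
`τ_r : (I''∖{t})∪{r} → J''` is the unique order-preserving bijection. -/
def Yqty (I J I'' J'' U : Finset ℕ) (s t r : ℕ) : ℤ :=
  Xqty I J s r +
    (lenN (insert r (I''.erase t)) (U.erase r)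
        (ordBij (insert r (I''.erase t)) J'') : ℤ) +
    (((insert r (I''.erase t)).filter fun a => r < a ∧ a < t).card : ℤ)

theorem nthEl_mem_s16 {L : Finset ℕ} {m : ℕ} (h₁ : 1 ≤ m) (h₂ : m ≤ L.card) : nthEl L m ∈ L := by
  have h : m - 1 < (L.sort (· ≤ ·)).length := by rw [Finset.length_sort]; omega
  rw [nthEl, List.getD_eq_getElem _ _ h, ← Finset.mem_sort (· ≤ ·)]
  exact List.getElem_mem h

theorem nthEl_lt_nthEl {L : Finset ℕ} {m n : ℕ} (h₁ : 1 ≤ m) (hmn : m < n) (h₂ : n ≤ L.card) :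
    nthEl L m < nthEl L n := by
  have hm : m - 1 < (L.sort (· ≤ ·)).length := by rw [Finset.length_sort]; omega
  have hn : n - 1 < (L.sort (· ≤ ·)).length := by rw [Finset.length_sort]; omega
  rw [nthEl, nthEl, List.getD_eq_getElem _ _ hm, List.getD_eq_getElem _ _ hn]
  exact (Finset.sortedLT_sort L).getElem_lt_getElem_of_lt (by omega)

theorem one_le_indN (K : Finset ℕ) (a : ℕ) : 1 ≤ indN K a :=
  Finset.card_pos.mpr ⟨a, by simp⟩

theorem indN_le_card {K : Finset ℕ} {a : ℕ} (ha : a ∈ K) : indN K a ≤ K.card := by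
  rw [indN, Finset.insert_eq_of_mem ha]
  exact Finset.card_filter_le _ _

theorem indN_lt_indN {K : Finset ℕ} {a b : ℕ} (ha : a ∈ K) (hb : b ∈ K) (hab : a < b) :
    indN K a < indN K b := by
  rw [indN, indN, Finset.insert_eq_of_mem ha, Finset.insert_eq_of_mem hb]
  refine Finset.card_lt_card (Finset.ssubset_iff_subset_ne.mpr ⟨fun x hx => ?_, fun h => ?_⟩)
  · simp only [Finset.mem_filter] at hx ⊢
    exact ⟨hx.1, by omega⟩
  · have : b ∈ K.filter (· ≤ a) := by rw [h]; simp [hb]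
    simp only [Finset.mem_filter] at this
    omega

theorem indN_insert_self {K : Finset ℕ} {r : ℕ} (hr : r ∉ K) :
    indN (insert r K) r = (K.filter (· < r)).card + 1 := by
  rw [indN, Finset.insert_idem, Finset.filter_insert, if_pos le_rfl,
    Finset.card_insert_of_notMem (by simp [hr])]
  congr 2
  refine Finset.filter_congr fun x hx => ?_
  have : x ≠ r := fun h => hr (h ▸ hx)
  omega

theorem ordBij_strictMonoOn {K L : Finset ℕ} (h : K.card = L.card) :
    StrictMonoOn (ordBij K L) K := by
  intro a ha b hb hab
  rw [Finset.mem_coe] at ha hb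
  simp only [ordBij, ha, hb, if_true]
  exact nthEl_lt_nthEl (one_le_indN K a) (indN_lt_indN ha hb hab) (h ▸ indN_le_card hb)

theorem image_ordBij {K L : Finset ℕ} (h : K.card = L.card) : K.image (ordBij K L) = L := by
  refine Finset.eq_of_subset_of_card_le (fun y hy => ?_) ?_
  · obtain ⟨a, ha, rfl⟩ := Finset.mem_image.mp hy
    simp only [ordBij, ha, if_true]
    exact nthEl_mem_s16 (one_le_indN K a) (h ▸ indN_le_card ha)
  · rw [Finset.card_image_of_injOn (ordBij_strictMonoOn h).injOn, h]

theorem ordBij_of_notMem {K L : Finset ℕ} {a : ℕ} (ha : a ∉ K) : ordBij K L a = a := by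
  simp [ordBij, ha]

/-- For a strictly increasing bijection extended by the identity, the length is the sum over the
fixed points of the number of strands crossing them. -/
theorem lenN_eq_sum_crossings {K V : Finset ℕ} {f : ℕ → ℕ} (hf : StrictMonoOn f K)
    (hKV : Disjoint K V) (hV : ∀ u ∈ V, f u = u) :
    lenN K V f = ∑ u ∈ V, ((K.filter fun a => a < u ∧ u < f a).card +
      (K.filter fun a => u < a ∧ f a < u).card) := by
  have hS : ((K ∪ V) ×ˢ (K ∪ V)).filter (fun p => p.1 < p.2 ∧ f p.2 < f p.1) =
      (K ×ˢ V).filter (fun p => p.1 < p.2 ∧ p.2 < f p.1) ∪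
      (V ×ˢ K).filter (fun p => p.1 < p.2 ∧ f p.2 < p.1) := by
    ext ⟨x, y⟩
    simp only [Finset.mem_filter, Finset.mem_product, Finset.mem_union]
    constructor
    · rintro ⟨⟨hx | hx, hy | hy⟩, hxy, h⟩
      · exact absurd (hf hx hy hxy) h.asymm
      · exact Or.inl ⟨⟨hx, hy⟩, hxy, by rwa [hV y hy] at h⟩
      · exact Or.inr ⟨⟨hx, hy⟩, hxy, by rwa [hV x hx] at h⟩
      · rw [hV x hx, hV y hy] at h
        exact absurd hxy h.asymm
    · rintro (⟨⟨hx, hy⟩, hxy, h⟩ | ⟨⟨hx, hy⟩, hxy, h⟩)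
      · exact ⟨⟨Or.inl hx, Or.inr hy⟩, hxy, by rwa [hV y hy]⟩
      · exact ⟨⟨Or.inr hx, Or.inl hy⟩, hxy, by rwa [hV x hx]⟩
  rw [lenN, hS, Finset.card_union_of_disjoint, Finset.sum_add_distrib]
  · simp only [Finset.card_filter]
    rw [Finset.sum_product_right, Finset.sum_product]
  · refine Finset.disjoint_filter_filter (Finset.disjoint_left.mpr ?_)
    rintro ⟨x, y⟩ hx hy
    rw [Finset.mem_product] at hx hy
    exact Finset.disjoint_left.mp hKV hx.1 hy.1

theorem crossings_eq_abs {K L : Finset ℕ} {f : ℕ → ℕ} (hf : StrictMonoOn f K)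
    (hL : K.image f = L) {u : ℕ} (huK : u ∉ K) (huL : u ∉ L) :
    (((K.filter fun a => a < u ∧ u < f a).card + (K.filter fun a => u < a ∧ f a < u).card : ℕ) : ℤ)
      = |((K.filter (· < u)).card : ℤ) - ((L.filter (· < u)).card : ℤ)| := by
  have hne : ∀ a ∈ K, a ≠ u ∧ f a ≠ u := fun a ha =>
    ⟨fun h => huK (h ▸ ha), fun h => huL (hL ▸ h ▸ Finset.mem_image_of_mem f ha)⟩
  have hLc : (L.filter (· < u)).card = (K.filter fun a => f a < u).card := by
    rw [← hL, Finset.filter_image, Finset.card_image_of_injOn]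
    exact hf.injOn.mono (Finset.coe_subset.mpr (Finset.filter_subset _ _))
  have h₁ : (K.filter (· < u)).card = (K.filter fun a => a < u ∧ u < f a).card +
      (K.filter fun a => a < u ∧ f a < u).card := by
    rw [← Finset.card_union_of_disjoint, ← Finset.filter_or]
    · congr 1
      refine Finset.filter_congr fun a ha => ?_
      have := hne a ha
      omega
    · exact Finset.disjoint_filter.mpr fun a _ h => by omega
  have h₂ : (K.filter fun a => f a < u).card = (K.filter fun a => u < a ∧ f a < u).card +
      (K.filter fun a => a < u ∧ f a < u).card := by
    rw [← Finset.card_union_of_disjoint, ← Finset.filter_or]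
    · congr 1
      refine Finset.filter_congr fun a ha => ?_
      have := hne a ha
      omega
    · exact Finset.disjoint_filter.mpr fun a _ h => by omega
  have h₀ : (K.filter fun a => a < u ∧ u < f a).card = 0 ∨
      (K.filter fun a => u < a ∧ f a < u).card = 0 := by
    by_contra! h
    obtain ⟨a, ha⟩ := Finset.card_ne_zero.mp h.1
    obtain ⟨b, hb⟩ := Finset.card_ne_zero.mp h.2
    rw [Finset.mem_filter] at ha hb
    have := hf ha.1 hb.1 (by omega)
    omega
  rw [hLc, h₁, h₂]
  push_cast
  rcases h₀ with h | h <;> rw [h] <;> simp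

theorem lenN_ordBij {K L V : Finset ℕ} (h : K.card = L.card) (hKV : Disjoint K V)
    (hLV : Disjoint L V) :
    (lenN K V (ordBij K L) : ℤ) =
      ∑ u ∈ V, |((K.filter (· < u)).card : ℤ) - ((L.filter (· < u)).card : ℤ)| := by
  rw [lenN_eq_sum_crossings (ordBij_strictMonoOn h) hKV
    fun u hu => ordBij_of_notMem (Finset.disjoint_right.mp hKV hu), Nat.cast_sum]
  exact Finset.sum_congr rfl fun u hu => crossings_eq_abs (ordBij_strictMonoOn h) (image_ordBij h)
    (Finset.disjoint_right.mp hKV hu) (Finset.disjoint_right.mp hLV hu)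

theorem card_filter_lt_add {K : Finset ℕ} {r r' : ℕ} (hr : r ∉ K) (h : r < r') :
    (K.filter (· < r')).card =
      (K.filter (· < r)).card + (K.filter fun a => r < a ∧ a < r').card := by
  rw [← Finset.card_union_of_disjoint, ← Finset.filter_or]
  · congr 1
    refine Finset.filter_congr fun a ha => ?_
    have : a ≠ r := fun h => hr (h ▸ ha)
    omega
  · exact Finset.disjoint_filter.mpr fun a _ h => by omega

/-- telescoping lemma. With `s > I`, `t ∉ J`, `s < t`,
`(I'',J'') ∈ Cl_k(I∪{s}, J∪{t})`, `t ∈ I''`, `U = [N]∖(I∪{s}∪I'')`: if `r < r'` are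
adjacent elements of `(s,t]∖I''`, then `Y(r') − Y(r) = 2`. -/
theorem telescoping_lemma (N k : ℕ) (hN : 1 ≤ N) (hk : k ≤ N) (I J : Finset ℕ)
    (hIN : I ⊆ Finset.Icc 1 N) (hJN : J ⊆ Finset.Icc 1 N)
    (hcard : I.card = J.card) (hm : I.card + 1 ≤ k)
    (s : ℕ) (hsN : s ∈ Finset.Icc 1 N) (hs : ∀ i ∈ I, i < s)
    (t : ℕ) (htN : t ∈ Finset.Icc 1 N) (ht : t ∉ J) (hst : s < t)
    (I'' J'' : Finset ℕ) (hC : (I'', J'') ∈ Cl N k (insert s I) (insert t J))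
    (htI : t ∈ I'')
    (U : Finset ℕ) (hU : U = Finset.Icc 1 N \ (insert s I ∪ I''))
    (r r' : ℕ)
    (hr : s < r ∧ r ≤ t ∧ r ∉ I'') (hr' : s < r' ∧ r' ≤ t ∧ r' ∉ I'')
    (hlt : r < r')
    (hadj : ∀ a, s < a → a ≤ t → a ∉ I'' → ¬(r < a ∧ a < r')) :
    Yqty I J I'' J'' U s t r' - Yqty I J I'' J'' U s t r = 2 := by
  obtain ⟨-, -, hgt, hcI, hcJ, hun⟩ := hC
  dsimp only at hgt hcI hcJ hun
  have hsI : s ∉ I := fun h => lt_irrefl _ (hs s h)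
  have hmem : ∀ x, (x = s ∨ x ∈ I) ∨ x ∈ I'' ↔ (x = t ∨ x ∈ J) ∨ x ∈ J'' := fun x => by
    simpa only [Finset.mem_union, Finset.mem_insert] using Finset.ext_iff.mp hun x
  have hdI : Disjoint (insert s I) I'' := Finset.disjoint_left.mpr fun x hx hx' =>
    lt_irrefl _ (hgt x hx' x hx)
  have hdJ : Disjoint (insert t J) J'' := by
    rw [← Finset.card_union_eq_card_add_card, ← hun, Finset.card_union_of_disjoint hdI, hcI, hcJ,
      Finset.card_insert_of_notMem hsI, Finset.card_insert_of_notMem ht, hcard]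
  have hcIJ : I''.card = J''.card := by
    rw [hcI, hcJ]
  have hout : ∀ x, s < x → x ∉ I'' → x ∉ J ∧ x ∉ J'' := fun x hx hxI => by
    have := hmem x
    have h2 : x ∉ I := fun h => by have := hs x h; omega
    have h3 : x ≠ s := by omega
    tauto
  obtain ⟨hrJ, hrJ''⟩ := hout r hr.1 hr.2.2
  obtain ⟨hrJ', hrJ'''⟩ := hout r' hr'.1 hr'.2.2
  have hrt' : r' < t := lt_of_le_of_ne hr'.2.1 fun h => hr'.2.2 (h ▸ htI)
  have hbetween : ∀ a, r < a → a < r' → a ∈ I'' := fun a h₁ h₂ => by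
    by_contra h
    exact hadj a (by omega) (by omega) h ⟨h₁, h₂⟩
  set K := I''.erase t with hK
  have hrK : r ∉ K := fun h => hr.2.2 (Finset.mem_of_mem_erase h)
  have hrK' : r' ∉ K := fun h => hr'.2.2 (Finset.mem_of_mem_erase h)
  have hUmem : ∀ x, s < x → x ≤ t → x ∉ I'' → x ∈ U := fun x h₁ h₂ h₃ => by
    have : x ∉ I := fun h => by have := hs x h; omega
    simp only [Finset.mem_Icc] at htN
    simp only [hU, Finset.mem_sdiff, Finset.mem_Icc, Finset.mem_union, Finset.mem_insert]
    refine ⟨by omega, ?_⟩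
    rintro ((h | h) | h)
    · omega
    · exact this h
    · exact h₃ h
  have hrU := hUmem r hr.1 hr.2.1 hr.2.2
  have hrU' := hUmem r' hr'.1 hr'.2.1 hr'.2.2
  have hUI : ∀ u ∈ U, u ∉ I'' := fun u hu h => by
    rw [hU, Finset.mem_sdiff] at hu
    exact hu.2 (Finset.mem_union_right _ h)
  have hUJ : Disjoint J'' U := Finset.disjoint_right.mpr fun u hu h => by
    rw [hU, hun, Finset.mem_sdiff] at hu
    exact hu.2 (Finset.mem_union_right _ h)
  have hcK : (K.filter fun a => r < a ∧ a < r').card = r' - r - 1 := by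
    rw [← Nat.card_Ioo]
    congr 1
    ext a
    simp only [hK, Finset.mem_filter, Finset.mem_erase, Finset.mem_Ioo]
    exact ⟨fun h => h.2, fun h => ⟨⟨by omega, hbetween a h.1 h.2⟩, h⟩⟩
  have hcJJ : (J.filter fun a => r < a ∧ a < r').card +
      (J''.filter fun a => r < a ∧ a < r').card = r' - r - 1 := by
    rw [← Nat.card_Ioo, ← Finset.card_union_of_disjoint, ← Finset.filter_union]
    · congr 1
      ext a
      simp only [Finset.mem_filter, Finset.mem_union, Finset.mem_Ioo]
      refine ⟨fun h => h.2, fun h => ⟨?_, h⟩⟩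
      have h₁ := (hmem a).mp (Or.inr (hbetween a h.1 h.2))
      have h₂ : a ≠ t := by omega
      tauto
    · exact Finset.disjoint_filter_filter
        (hdJ.mono_left (Finset.subset_insert _ _))
  have hbelow : (K.filter (· < r')).card + 1 ≤ (J''.filter (· < r')).card := by
    have h₁ : (insert s I ∪ K.filter (· < r')).card = I.card + 1 + (K.filter (· < r')).card := by
      rw [Finset.card_union_of_disjoint, Finset.card_insert_of_notMem hsI]
      exact hdI.mono_right ((Finset.filter_subset _ _).trans (Finset.erase_subset _ _))
    have h₂ : insert s I ∪ K.filter (· < r') ⊆ J ∪ J''.filter (· < r') := by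
      intro x hx
      simp only [hK, Finset.mem_union, Finset.mem_insert, Finset.mem_filter,
        Finset.mem_erase] at hx ⊢
      have hx' : x < r' := by
        rcases hx with (h | h) | h
        · omega
        · have := hs x h
          omega
        · exact h.2
      have h₁ := hmem x
      have h₂ : x ≠ t := by omega
      tauto
    have h₃ := (Finset.card_le_card h₂).trans (Finset.card_union_le _ _)
    omega
  have hX : Xqty I J s r' - Xqty I J s r =
      1 + ((J''.filter fun a => r < a ∧ a < r').card : ℤ) := by
    have hz : ∀ x, s < x → (I.filter fun i => min s x ≤ i ∧ i ≤ max s x).card = 0 := fun x hx => by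
      rw [Finset.card_eq_zero, Finset.filter_eq_empty_iff]
      intro i hi
      have := hs i hi
      omega
    rw [Xqty, Xqty, hz r hr.1, hz r' hr'.1, indN_insert_self hrJ, indN_insert_self hrJ',
      card_filter_lt_add hrJ hlt, abs_of_nonneg (by omega), abs_of_nonneg (by omega)]
    push_cast
    omega
  have hT : ∀ x, x ∉ K → x < t → ((insert x K).filter fun a => x < a ∧ a < t).card +
      (K.filter (· < x)).card = (K.filter (· < t)).card := fun x hxK hx => by
    rw [Finset.filter_insert, if_neg (by omega), card_filter_lt_add hxK hx, add_comm]
  have hL : ∀ x ∈ U, x ∉ K → s < x → (lenN (insert x K) (U.erase x)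
      (ordBij (insert x K) J'') : ℤ) = ∑ u ∈ U.erase x,
        |(((insert x K).filter (· < u)).card : ℤ) - ((J''.filter (· < u)).card : ℤ)| := by
    intro x hxU hxK hx
    refine lenN_ordBij ?_ ?_ (hUJ.mono_right (Finset.erase_subset _ _))
    · rw [Finset.card_insert_of_notMem hxK, hK, Finset.card_erase_add_one htI, hcIJ]
    · refine Finset.disjoint_right.mpr fun u hu h => ?_
      rw [Finset.mem_erase] at hu
      rcases Finset.mem_insert.mp h with h | h
      · exact hu.1 h
      · exact hUI u hu.2 (Finset.mem_of_mem_erase h)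
  have hlen := hL r hrU hrK hr.1
  have hlen' := hL r' hrU' hrK' hr'.1
  have hrest : ∑ u ∈ (U.erase r).erase r',
        |(((insert r K).filter (· < u)).card : ℤ) - ((J''.filter (· < u)).card : ℤ)| =
      ∑ u ∈ (U.erase r').erase r,
        |(((insert r' K).filter (· < u)).card : ℤ) - ((J''.filter (· < u)).card : ℤ)| := by
    rw [Finset.erase_right_comm]
    refine Finset.sum_congr rfl fun u hu => ?_
    simp only [Finset.mem_erase] at hu
    have hiff : r < u ↔ r' < u := by
      have h₁ := fun h h' => hUI u hu.2.2 (hbetween u h h')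
      have h₂ := hu.1
      have h₃ := hu.2.1
      constructor
      · intro h
        by_contra h'
        exact h₁ h (by omega)
      · omega
    have hc : ((insert r K).filter (· < u)).card = ((insert r' K).filter (· < u)).card := by
      rw [Finset.filter_insert, Finset.filter_insert]
      by_cases h : r < u
      · rw [if_pos h, if_pos (hiff.mp h), Finset.card_insert_of_notMem (by simp [hrK]),
          Finset.card_insert_of_notMem (by simp [hrK'])]
      · rw [if_neg h, if_neg (fun h' => h (hiff.mpr h'))]
    rw [hc]
  rw [← Finset.add_sum_erase _ _ (Finset.mem_erase.mpr ⟨hlt.ne', hrU'⟩), hrest] at hlen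
  rw [← Finset.add_sum_erase _ _ (Finset.mem_erase.mpr ⟨hlt.ne, hrU⟩)] at hlen'
  rw [Finset.filter_insert, if_pos hlt, Finset.card_insert_of_notMem (by simp [hrK])] at hlen
  rw [Finset.filter_insert, if_neg (by omega)] at hlen'
  have hKr := card_filter_lt_add hrK hlt
  have hJr := card_filter_lt_add hrJ'' hlt
  have hTr := hT r hrK (by omega)
  have hTr' := hT r' hrK' hrt'
  rw [abs_of_nonpos (by push_cast; omega)] at hlen
  rw [abs_of_nonpos (by omega)] at hlen'
  rw [Yqty, Yqty, ← hK]
  push_cast at hlen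
  omega

end
end
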